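/- arXiv:2512.04896 — 2 statements merged into one kernel-verified Lean document; each statement's English description precedes it below -/
import Mathlib

section
/- Let (K, v) be a henselian valued field, f ∈ 𝒪_v[X] monic of prime degree p whose splitting field over K is a cyclic extension of degree p. Let t ∈ K satisfy p(p−1)·v(t) > p·v(Disc(f)) − (p−1)²·v(f(0)). Then the splitting field of f_t(X) = f(X) + t·X^{p−1} over K contains the splitting field of f over K. -/
open Polynomial Module

open scoped Pointwise in
/-- An integral domain with a finite group action whose ring of invariants is a Henselian local
ring is itself local. -/
theorem HenselianLocalRing.isLocalRing_of_isInvariant (A B G : Type*) [CommRing A]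
    [HenselianLocalRing A] [CommRing B] [IsDomain B] [Algebra A B] [Group G] [Finite G]
    [MulSemiringAction G B] [SMulCommClass G A B] [Algebra.IsInvariant A B G] :
    IsLocalRing B := by
  classical
  cases nonempty_fintype G
  have : Algebra.IsIntegral A B := Algebra.IsInvariant.isIntegral A B G
  obtain ⟨m, hm⟩ := Ideal.exists_maximal B
  have hunder (n : Ideal B) [n.IsMaximal] : n.under A = IsLocalRing.maximalIdeal A :=
    IsLocalRing.eq_maximalIdeal (Ideal.isMaximal_comap_of_isIntegral_of_isMaximal n)
  have hmem (n : Ideal B) [n.IsMaximal] (a : A) :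
      algebraMap A B a ∈ n ↔ a ∈ IsLocalRing.maximalIdeal A := by
    rw [← hunder n, Ideal.under_def, Ideal.mem_comap]
  have hmax (g : G) : (g • m).IsMaximal := by
    rw [Ideal.pointwise_smul_eq_comap]
    exact Ideal.comap_isMaximal_of_equiv _
  refine IsLocalRing.of_unique_max_ideal ⟨m, hm, fun n hn ↦ ?_⟩
  obtain ⟨g₀, rfl⟩ := Algebra.IsInvariant.exists_smul_of_under_eq A B G m n
    ((hunder m).trans (hunder n).symm)
  by_contra hg₀
  -- An element close to `1` at `m` and to `0` at the other conjugates of `m`.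
  obtain ⟨b, hb, hb'⟩ : ∃ b : B, 1 - b ∈ m ∧ ∀ g : G, g • m ≠ m → b ∈ g • m := by
    have h : m ⊔ ⨅ g ∈ Finset.univ.filter (fun g : G ↦ g • m ≠ m), g • m = ⊤ := by
      refine Ideal.sup_iInf_eq_top fun g hg ↦ ?_
      exact Ideal.IsMaximal.coprime_of_ne hm (hmax g) (Finset.mem_filter.1 hg).2.symm
    obtain ⟨x, hx, y, hy, hxy⟩ := Submodule.mem_sup.1 ((Ideal.eq_top_iff_one _).1 h)
    refine ⟨y, by rwa [← hxy, add_sub_cancel_right], fun g hg ↦ ?_⟩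
    simp only [Ideal.mem_iInf] at hy
    exact hy g (by simpa using hg)
  let D := MulAction.stabilizer G m
  obtain ⟨β, hβ, hβ', hβD⟩ : ∃ β : B, 1 - β ∈ m ∧ (∀ g : G, g • m ≠ m → β ∈ g • m) ∧
      ∀ g : G, g • m = m → g • β = β := by
    refine ⟨∏ h : D, h • b, ?_, fun g hg ↦ ?_, fun g hg ↦ ?_⟩
    · rw [← Ideal.Quotient.eq_zero_iff_mem, map_sub, map_prod, map_one, sub_eq_zero, eq_comm]
      refine Finset.prod_eq_one fun h _ ↦ ?_
      rw [← sub_eq_zero, ← neg_eq_zero, neg_sub, ← map_one (Ideal.Quotient.mk m), ← map_sub,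
        Ideal.Quotient.eq_zero_iff_mem]
      have : (h : G) • (1 - b) ∈ (h : G) • m := Ideal.smul_mem_pointwise_smul _ _ _ hb
      rwa [smul_sub, smul_one, h.2] at this
    · refine Ideal.mem_of_dvd _ (Finset.dvd_prod_of_mem _ (Finset.mem_univ (1 : D))) ?_
      simpa using hb' g hg
    · exact Finset.smul_prod_perm b (⟨g, hg⟩ : D)
  have hconj (c : B) (hc : c ∈ MulAction.orbit G β) (hne : c ≠ β) : c ∈ m := by
    obtain ⟨g, rfl⟩ := hc
    have hg : g⁻¹ • m ≠ m := fun h ↦ hne (hβD g (by rw [← h, smul_inv_smul, h]))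
    exact Ideal.mem_inv_pointwise_smul_iff.1 (hβ' g⁻¹ hg)
  let O : Finset B := Finset.univ.image fun g : G ↦ g • β
  have hO (c : B) : c ∈ O ↔ c ∈ MulAction.orbit G β := by simp [O, MulAction.mem_orbit_iff]
  let h : B[X] := ∏ c ∈ O, (X - C c)
  have hmonic : h.Monic := monic_prod_of_monic _ _ fun c _ ↦ monic_X_sub_C c
  have hinv (g : G) : g • h = h := by
    simp only [h, Finset.smul_prod', smul_sub, smul_X, smul_C]
    refine Finset.prod_bij (fun c _ ↦ g • c) ?_ ?_ ?_ ?_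
    · intro c hc
      rw [hO] at hc ⊢
      exact MulAction.mem_orbit_of_mem_orbit _ hc
    · intro c _ d _ hcd
      exact smul_left_cancel g hcd
    · intro c hc
      refine ⟨g⁻¹ • c, ?_, smul_inv_smul g c⟩
      rw [hO] at hc ⊢
      exact MulAction.mem_orbit_of_mem_orbit _ hc
    · intros; rfl
  obtain ⟨q, hq, -, hqm⟩ := lifts_and_natDegree_eq_and_monic (f := algebraMap A B) (p := h)
    ((lifts_iff_coeff_lifts _).2 fun n ↦ Algebra.IsInvariant.isInvariant (G := G) _ fun g ↦ by
      rw [← Polynomial.coeff_smul, hinv]) hmonic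
  have hβO : β ∈ O := (hO β).2 (MulAction.mem_orbit_self β)
  have hfac : h = (X - C β) * ∏ c ∈ O.erase β, (X - C c) := (Finset.mul_prod_erase O _ hβO).symm
  have hprod : eval 1 (∏ c ∈ O.erase β, (X - C c)) ∉ m := by
    rw [eval_prod, hm.isPrime.prod_mem_iff]
    rintro ⟨c, hc, hcm⟩
    rw [Finset.mem_erase, hO] at hc
    refine hm.ne_top ((Ideal.eq_top_iff_one m).2 ?_)
    simpa using m.add_mem hcm (hconj c hc.2 hc.1)
  have heval (r : A[X]) (a : A) : algebraMap A B (r.eval a) =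
      (r.map (algebraMap A B)).eval (algebraMap A B a) := (eval_map_apply ..).symm
  obtain ⟨a, ha, ha'⟩ := HenselianLocalRing.is_henselian q hqm 1 (by
      rw [← hmem m, heval, hq, map_one, hfac, eval_mul]
      refine m.mul_mem_right _ ?_
      simpa using hβ) (by
      by_contra hu
      rw [← mem_nonunits_iff, ← IsLocalRing.mem_maximalIdeal, ← hmem m, heval, ← derivative_map,
        hq, map_one, hfac, derivative_mul, eval_add, eval_mul, eval_mul] at hu
      refine hprod ?_
      have := m.sub_mem hu (m.mul_mem_right
        (eval 1 (derivative (∏ c ∈ O.erase β, (X - C c)))) hβ)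
      simpa using this)
  have ha0 : ∏ c ∈ O, (algebraMap A B a - c) = 0 := by
    have := heval q a
    rw [ha, map_zero, hq, eval_prod] at this
    simpa using this.symm
  obtain ⟨c, hc, hac⟩ := Finset.prod_eq_zero_iff.1 ha0
  obtain ⟨g, rfl⟩ := (hO c).1 hc
  have hβa : β = algebraMap A B a := by
    have h1 : g • β = algebraMap A B a := (sub_eq_zero.1 hac).symm
    rw [← smul_algebraMap g⁻¹ a, ← h1, inv_smul_smul]
  have h1 : algebraMap A B a ∈ g₀ • m := hβa ▸ hβ' g₀ hg₀
  rw [hmem] at h1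
  have h2 := (IsLocalRing.maximalIdeal A).sub_mem h1 ha'
  rw [sub_sub_cancel] at h2
  exact (Ideal.ne_top_iff_one _).1 (IsLocalRing.maximalIdeal.isMaximal A).ne_top h2

/-- The integral closure of a Henselian local ring in a finite normal extension of its field of
fractions is local. -/
theorem HenselianLocalRing.isLocalRing_integralClosure (R K M : Type*) [CommRing R] [IsDomain R]
    [IsIntegrallyClosed R] [HenselianLocalRing R] [Field K] [Algebra R K] [IsFractionRing R K]
    [Field M] [Algebra K M] [Algebra R M] [IsScalarTower R K M] [FiniteDimensional K M]
    [Normal K M] : IsLocalRing (integralClosure R M) := by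
  let N := separableClosure K M
  have hN : IsLocalRing (integralClosure R N) := by
    have : IsFractionRing (integralClosure R N) N :=
      integralClosure.isFractionRing_of_finite_extension K N
    let := IsIntegralClosure.MulSemiringAction R K N (integralClosure R N)
    have := Algebra.isInvariant_of_isGalois R K N (integralClosure R N)
    have : SMulCommClass Gal(N/K) R (integralClosure R N) :=
      ⟨fun g r b ↦ map_smul (galRestrict R K N (integralClosure R N) g) r b⟩
    exact HenselianLocalRing.isLocalRing_of_isInvariant R (integralClosure R N) Gal(N/K)
  obtain ⟨q, hq⟩ := ExpChar.exists N
  have : ExpChar M q := expChar_of_injective_algebraMap (algebraMap N M).injective q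
  have : ExpChar (integralClosure R M) q :=
    (RingHom.expChar_iff (algebraMap (integralClosure R M) M)
      (FaithfulSMul.algebraMap_injective _ _) q).2 this
  have : IsScalarTower R N M := .of_algebraMap_eq fun r ↦ by
    rw [IsScalarTower.algebraMap_apply R K M, IsScalarTower.algebraMap_apply R K N,
      ← IsScalarTower.algebraMap_apply K N M]
  let ι : integralClosure R N →+* integralClosure R M :=
    ((IsScalarTower.toAlgHom R N M).mapIntegralClosure).toRingHom
  refine IsLocalRing.of_isUnit_or_isUnit_one_sub_self fun b ↦ ?_
  obtain ⟨n, c, hc⟩ := IsPurelyInseparable.pow_mem N q (b : M)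
  have hci : IsIntegral R c := by
    rw [← isIntegral_algebraMap_iff (algebraMap N M).injective, hc]
    exact b.2.pow _
  have hι : ι ⟨c, hci⟩ = b ^ q ^ n := Subtype.ext hc
  have hq0 : q ^ n ≠ 0 := pow_ne_zero _ (expChar_pos N q).ne'
  refine (IsLocalRing.isUnit_or_isUnit_one_sub_self (⟨c, hci⟩ : integralClosure R N)).imp
    (fun h ↦ ?_) fun h ↦ ?_
  · rw [← isUnit_pow_iff hq0, ← hι]
    exact h.map ι
  · rw [← isUnit_pow_iff hq0, sub_pow_expChar_pow, one_pow, ← hι, ← map_one ι, ← map_sub]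
    exact h.map ι

/-- If a local ring `B` is integrally closed in a field, then a root `x` of a polynomial over `B`
with a unit coefficient satisfies `x ∈ B` or `x⁻¹ ∈ B`. -/
theorem IsLocalRing.mem_range_or_inv_mem_range_of_aeval_eq_zero {B M : Type*} [CommRing B]
    [IsLocalRing B] [Field M] [Algebra B M] (hB : ∀ z : M, IsIntegral B z → z ∈ (algebraMap B M).range)
    (x : M) (q : B[X]) (hq : aeval x q = 0) (hu : ∃ i, IsUnit (q.coeff i)) :
    x ∈ (algebraMap B M).range ∨ x⁻¹ ∈ (algebraMap B M).range := by
  induction hn : q.natDegree using Nat.strong_induction_on generalizing q with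
  | _ n ih =>
  obtain ⟨i, hi⟩ := hu
  have hne : i ≤ n := hn ▸ le_natDegree_of_ne_zero hi.ne_zero
  obtain ⟨b, hb⟩ := hB _ (isIntegral_leadingCoeff_smul q x hq)
  rw [Algebra.smul_def] at hb
  by_cases hl : IsUnit q.leadingCoeff
  · obtain ⟨u, hu⟩ := hl
    left
    refine ⟨↑u⁻¹ * b, ?_⟩
    rw [map_mul, hb, ← hu, ← mul_assoc, ← map_mul, Units.inv_mul, map_one, one_mul]
  by_cases hbu : IsUnit b
  · obtain ⟨u, rfl⟩ := hbu
    right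
    refine ⟨↑u⁻¹ * q.leadingCoeff, ?_⟩
    refine eq_inv_of_mul_eq_one_left ?_
    rw [map_mul, mul_assoc, ← hb, ← map_mul, Units.inv_mul, map_one]
  have hin : i ≠ n := by
    rintro rfl
    rw [← hn] at hi
    exact hl hi
  have hn1 : n - 1 + 1 = n := by omega
  let r : B[X] := q.eraseLead + C b * X ^ (n - 1)
  have hr : aeval x r = 0 := by
    have h := hq
    rw [← eraseLead_add_C_mul_X_pow q, map_add, hn] at h
    rw [← h]
    simp only [r, map_add, map_mul, aeval_C, map_pow, aeval_X, hb]
    conv_rhs => rw [← hn1, pow_succ]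
    ring
  have hrd : r.natDegree < n := by
    refine lt_of_le_of_lt (natDegree_add_le _ _) (max_lt ?_ ?_)
    · have := eraseLead_natDegree_le q
      omega
    · have := natDegree_C_mul_X_pow_le b (n - 1)
      omega
  refine ih _ hrd r hr ⟨i, ?_⟩ rfl
  simp only [r, coeff_add, coeff_C_mul_X_pow]
  rw [eraseLead_coeff_of_ne i (by rwa [hn])]
  split_ifs
  · by_contra hs
    refine (IsLocalRing.mem_maximalIdeal _).1 ?_ hi
    have := (IsLocalRing.maximalIdeal B).sub_mem ((IsLocalRing.mem_maximalIdeal _).2 hs)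
      ((IsLocalRing.mem_maximalIdeal _).2 hbu)
    rwa [add_sub_cancel_right] at this
  · rwa [add_zero]

/-- In a valuation ring, a nonempty finite family has a member dividing all the others. -/
theorem ValuationRing.exists_mem_forall_dvd {R ι : Type*} [CommRing R] [IsDomain R]
    [ValuationRing R] (s : Finset ι) (hs : s.Nonempty) (c : ι → R) :
    ∃ i ∈ s, ∀ j ∈ s, c i ∣ c j := by
  induction hs using Finset.Nonempty.cons_induction with
  | singleton a => simp
  | cons a s ha hs ih =>
    obtain ⟨i, hi, hmin⟩ := ih
    obtain h | h := ValuationRing.dvd_total (c a) (c i)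
    · exact ⟨a, by simp, by simpa using fun j hj ↦ h.trans (hmin j hj)⟩
    · exact ⟨i, by simp [hi], by simpa [h] using hmin⟩

/-- The integral closure of a Henselian valuation ring in a finite normal extension of its field
of fractions is a valuation ring. -/
theorem ValuationSubring.exists_mem_iff_isIntegral (R K M : Type*) [CommRing R] [IsDomain R]
    [ValuationRing R] [HenselianLocalRing R] [Field K] [Algebra R K] [IsFractionRing R K]
    [Field M] [Algebra K M] [Algebra R M] [IsScalarTower R K M] [FiniteDimensional K M]
    [Normal K M] : ∃ A : ValuationSubring M, ∀ z, z ∈ A ↔ IsIntegral R z := by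
  have := HenselianLocalRing.isLocalRing_integralClosure R K M
  refine ⟨⟨(integralClosure R M).toSubring, fun x ↦ ?_⟩, fun z ↦ Iff.rfl⟩
  have : FaithfulSMul R M := by
    rw [faithfulSMul_iff_algebraMap_injective, IsScalarTower.algebraMap_eq R K M]
    exact (algebraMap K M).injective.comp (IsFractionRing.injective R K)
  obtain ⟨q, hq, hqx⟩ : IsAlgebraic R x :=
    (IsFractionRing.isAlgebraic_iff R K M).2 (Algebra.IsAlgebraic.isAlgebraic x)
  obtain ⟨r, hr, hrx⟩ : ∃ r : R[X], (∃ i, IsUnit (r.coeff i)) ∧ aeval x r = 0 := by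
    obtain ⟨i, hi, hmin⟩ :=
      ValuationRing.exists_mem_forall_dvd q.support (support_nonempty.2 hq) q.coeff
    have hi0 : q.coeff i ≠ 0 := mem_support_iff.1 hi
    obtain ⟨r, hr⟩ : C (q.coeff i) ∣ q := (C_dvd_iff_dvd_coeff _ _).2 fun j ↦ by
      by_cases hj : j ∈ q.support
      · exact hmin j hj
      · rw [notMem_support_iff.1 hj]
        exact dvd_zero _
    refine ⟨r, ⟨i, ?_⟩, ?_⟩
    · have h := congrArg (coeff · i) hr
      rw [coeff_C_mul, eq_comm, mul_eq_left₀ hi0] at h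
      exact h ▸ isUnit_one
    · rw [hr, map_mul, aeval_C, mul_eq_zero] at hqx
      exact hqx.resolve_left ((map_ne_zero_iff _ (FaithfulSMul.algebraMap_injective R M)).2 hi0)
  have hB (z : M) (hz : IsIntegral (integralClosure R M) z) :
      z ∈ (algebraMap (integralClosure R M) M).range :=
    ⟨⟨z, isIntegral_trans z hz⟩, rfl⟩
  have := IsLocalRing.mem_range_or_inv_mem_range_of_aeval_eq_zero hB x
    (r.map (algebraMap R (integralClosure R M))) (by rwa [aeval_map_algebraMap])
    (hr.imp fun i hi ↦ by rw [coeff_map]; exact hi.map _)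
  refine this.imp ?_ ?_ <;>
  · rintro ⟨y, hy⟩
    exact hy ▸ y.2

/-- A valuation whose unit ball consists of the integral elements is invariant under
automorphisms. -/
theorem Valuation.map_algEquiv_of_le_one_iff_isIntegral {R K L Γ : Type*} [CommRing R] [Field K]
    [Field L] [Algebra R K] [Algebra K L] [Algebra R L] [IsScalarTower R K L]
    [FiniteDimensional K L] [LinearOrderedCommGroupWithZero Γ] (u : Valuation L Γ)
    (hu : ∀ z, u z ≤ 1 ↔ IsIntegral R z) (σ : L ≃ₐ[K] L) (z : L) : u (σ z) = u z := by
  have hle (τ : L ≃ₐ[K] L) (z : L) (hz : u z ≤ 1) : u (τ z) ≤ 1 :=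
    (hu _).2 (((hu _).1 hz).map (τ.restrictScalars R))
  have hequiv (σ : L ≃ₐ[K] L) : u.IsEquiv (u.comap (σ : L →+* L)) :=
    Valuation.isEquiv_iff_val_le_one.2 fun {z} ↦
      ⟨hle σ z, fun h ↦ by simpa using hle σ.symm (σ z) h⟩
  have key (σ : L ≃ₐ[K] L) (z : L) : u z ≤ u (σ z) := by
    by_contra! hlt
    have hiter (n : ℕ) : u ((σ ^ (n + 1)) z) < u z := by
      induction n with
      | zero => simpa using hlt
      | succ n ih =>
        rw [pow_succ', AlgEquiv.mul_apply]
        exact ((hequiv σ).lt_iff_lt.1 ih).trans hlt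
    have := hiter (orderOf σ - 1)
    rw [Nat.sub_add_cancel (orderOf_pos σ), pow_orderOf_eq_one] at this
    exact this.ne rfl
  exact le_antisymm (by simpa using key σ.symm (σ z)) (key σ z)

/-- In a group of prime order acting by isometries, the distance between a point and its image
under a nontrivial element does not depend on this element. -/
theorem Valuation.map_sub_eq_of_card_prime {K L Γ : Type*} [Field K] [Field L] [Algebra K L]
    [LinearOrderedCommGroupWithZero Γ] (u : Valuation L Γ) {p : ℕ} [Fact p.Prime]
    (hcard : Nat.card (L ≃ₐ[K] L) = p) (hu : ∀ (σ : L ≃ₐ[K] L) z, u (σ z) = u z)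
    {σ τ : L ≃ₐ[K] L} (hσ : σ ≠ 1) (hτ : τ ≠ 1) (z : L) : u (σ z - z) = u (τ z - z) := by
  have key {σ τ : L ≃ₐ[K] L} (hσ : σ ≠ 1) : u (τ z - z) ≤ u (σ z - z) := by
    obtain ⟨k, rfl⟩ := mem_powers_of_prime_card hcard hσ (g' := τ)
    induction k with
    | zero => simp
    | succ k ih =>
      have : (σ ^ (k + 1)) z - z = σ ((σ ^ k) z - z) + (σ z - z) := by
        rw [pow_succ', AlgEquiv.mul_apply, _root_.map_sub]; ring
      simp only [this]
      exact (u.map_add _ _).trans (max_le ((hu _ _).le.trans ih) le_rfl)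
  exact le_antisymm (key hτ) (key hσ)

/-- Krasner's lemma for a valuation that is invariant under automorphisms. -/
theorem Valuation.mem_intermediateField_of_krasner {K M Γ : Type*} [Field K] [Field M]
    [Algebra K M] [Normal K M] [LinearOrderedCommGroupWithZero Γ] (u : Valuation M Γ)
    (hu : ∀ (σ : M ≃ₐ[K] M) z, u (σ z) = u z) (S : IntermediateField K M) {x y : M}
    (hx : IsSeparable K x) (hy : y ∈ S)
    (h : ∀ x', IsConjRoot K x x' → x ≠ x' → u (x - y) < u (x - x')) : x ∈ S := by
  by_contra hxS
  have hbot : x ∉ (⊥ : Subalgebra S M) := by simpa [Algebra.mem_bot] using hxS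
  obtain ⟨x', hne, hx'⟩ := (notMem_iff_exists_ne_and_isConjRoot (hx.tower_top S)
    (IsIntegral.minpoly_splits_tower_top hx.isIntegral (Normal.splits' x))).1 hbot
  obtain ⟨σ, hσ⟩ := isConjRoot_iff_exists_algEquiv.1 hx'.symm
  have hσy : σ y = y := σ.commutes ⟨y, hy⟩
  have hlt := h x' (hx'.of_isScalarTower hx.isIntegral) hne
  have h1 : u (x' - y) = u (x - y) := by
    rw [← hσ, ← hu (σ.restrictScalars K) (x - y)]
    simp [hσy]
  refine hlt.not_ge ?_
  calc u (x - x') = u ((x - y) - (x' - y)) := by rw [sub_sub_sub_cancel_right]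
    _ ≤ max (u (x - y)) (u (x' - y)) := u.map_sub _ _
    _ = u (x - y) := by rw [h1, max_self]

/-- If the value of a monic split polynomial at `z` is less than `d ^ deg`, then one of its roots
is at distance less than `d` from `z`. -/
theorem Valuation.exists_root_map_sub_lt {M Γ : Type*} [Field M]
    [LinearOrderedCommGroupWithZero Γ] (u : Valuation M Γ) {q : M[X]} (hq : q.Monic)
    (hs : q.Splits) (z : M) {d : Γ} (h : u (q.eval z) < d ^ q.natDegree) :
    ∃ y ∈ q.roots, u (z - y) < d := by
  by_contra! hd
  refine h.not_ge ?_
  rw [hs.eval_eq_prod_roots_of_monic hq, hs.natDegree_eq_card_roots]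
  generalize q.roots = s at hd
  induction s using Multiset.induction with
  | empty => simp
  | cons a s ih =>
    simp only [Multiset.map_cons, Multiset.prod_cons, map_mul, Multiset.card_cons, pow_succ']
    exact mul_le_mul' (hd a (by simp)) (ih fun y hy ↦ hd y (by simp [hy]))

/-- The product of the squared differences of the roots is rational. -/
theorem exists_algebraMap_eq_prod_sub_sq {K L : Type*} [Field K] [Field L] [Algebra K L]
    [FiniteDimensional K L] [IsGalois K L] {n : ℕ} {f : K[X]} (x : Fin n → L)
    (hx : Function.Injective x) (hf : f.map (algebraMap K L) = ∏ i, (X - C (x i))) :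
    ∃ D : K, algebraMap K L D = ∏ i, ∏ j, if i < j then (x i - x j) ^ 2 else 1 := by
  rw [← Set.mem_range, IsGalois.mem_range_algebraMap_iff_fixed]
  intro σ
  have hV : (∏ i, ∏ j, if i < j then (x i - x j) ^ 2 else 1) =
      (Matrix.vandermonde x).det ^ 2 := by
    rw [Matrix.det_vandermonde, ← Finset.prod_pow]
    refine Finset.prod_congr rfl fun i _ ↦ ?_
    rw [← Finset.prod_pow, ← Finset.prod_filter]
    refine Finset.prod_congr (by ext; simp) fun j _ ↦ by ring
  have hroot (z : L) : aeval z f = 0 ↔ z ∈ Set.range x := by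
    rw [← eval_map_algebraMap, hf, eval_prod]
    simp [Finset.prod_eq_zero_iff, sub_eq_zero, eq_comm (a := z)]
  have hperm (i : Fin n) : ∃ j, x j = σ (x i) := by
    rw [← Set.mem_range, ← hroot]
    have := (hroot (x i)).2 ⟨i, rfl⟩
    rw [← AlgEquiv.coe_toAlgHom, aeval_algHom_apply, this, map_zero]
  choose π hπ using hperm
  have hπi : Function.Injective π := fun i j h ↦ hx (σ.injective (by rw [← hπ, ← hπ, h]))
  let e : Equiv.Perm (Fin n) := Equiv.ofBijective π (Finite.injective_iff_bijective.1 hπi)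
  have he : σ (Matrix.vandermonde x).det = ((Matrix.vandermonde x).submatrix e id).det := by
    rw [← RingHom.coe_coe, RingHom.map_det]
    congr 1
    ext i j
    simp [Matrix.vandermonde, e, hπ]
  rw [hV, map_pow, he, Matrix.det_permute, mul_pow]
  rcases Int.units_eq_one_or (Equiv.Perm.sign e) with h | h <;> simp [h]

/-- A product over ordered pairs of squares of a constant. -/
theorem prod_prod_ite_lt_sq {M : Type*} [CommMonoid M] (n : ℕ) (d : M) :
    (∏ i : Fin n, ∏ j : Fin n, if i < j then d ^ 2 else 1) = d ^ (n * (n - 1)) := by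
  have h1 (i j : Fin n) : (if i < j then d ^ 2 else 1) =
      (if i < j then d else 1) * if i < j then d else 1 := by
    split_ifs <;> simp [sq]
  have h2 (i j : Fin n) : (if i < j then d else 1) * (if j < i then d else 1) =
      if i = j then 1 else d := by
    rcases lt_trichotomy i j with h | rfl | h
    · simp [h, h.not_gt, h.ne]
    · simp
    · simp [h, h.not_gt, h.ne']
  simp_rw [h1, Finset.prod_mul_distrib]
  rw [Finset.prod_comm (f := fun i j : Fin n ↦ if i < j then d else 1)]
  nth_rw 1 [Finset.prod_comm]
  simp_rw [← Finset.prod_mul_distrib, h2, Finset.prod_ite, Finset.prod_const, one_pow, one_mul]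
  have h3 (i : Fin n) : (Finset.univ.filter fun j ↦ ¬ i = j).card = n - 1 := by
    simp [Finset.filter_not, Finset.filter_eq, Finset.card_sdiff]
  simp [h3, ← pow_mul, mul_comm]

/-- If the splitting field of a polynomial of prime degree `p` has degree `p`, then its
automorphisms permute the roots transitively. -/
theorem exists_algEquiv_apply_eq_of_finrank_eq_prime {K L : Type*} [Field K] [Field L]
    [Algebra K L] [IsGalois K L] {f : K[X]} [IsSplittingField K L f] (hf : f.Monic)
    (hp : f.natDegree.Prime) (hdim : finrank K L = f.natDegree) {x y : L}
    (hx : aeval x f = 0) (hy : aeval y f = 0) : ∃ σ : L ≃ₐ[K] L, σ x = y := by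
  have : FiniteDimensional K L := IsSplittingField.finiteDimensional L f
  obtain ⟨z, hz, hzK⟩ : ∃ z : L, aeval z f = 0 ∧ z ∉ (algebraMap K L).range := by
    by_contra! h
    have hbot : (⊤ : Subalgebra K L) = ⊥ := by
      rw [← IsSplittingField.adjoin_rootSet L f, ← le_bot_iff, Algebra.adjoin_le_iff]
      exact fun z hz ↦ h z (aeval_eq_zero_of_mem_rootSet hz)
    have := Subalgebra.bot_eq_top_iff_finrank_eq_one.1 hbot.symm
    exact hp.ne_one (hdim ▸ this)
  have hint (w : L) : IsIntegral K w := Algebra.IsIntegral.isIntegral w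
  have hdeg : (minpoly K z).natDegree = f.natDegree := by
    refine ((Nat.dvd_prime hp).1 (hdim ▸ minpoly.degree_dvd (hint z))).resolve_left fun h ↦ ?_
    exact hzK (minpoly.natDegree_eq_one_iff.1 h)
  have hfz : minpoly K z = f :=
    (eq_of_monic_of_dvd_of_natDegree_le (minpoly.monic (hint z)) hf (minpoly.dvd K z hz)
      hdeg.ge).symm
  have hirr : Irreducible f := hfz ▸ minpoly.irreducible (hint z)
  refine minpoly.exists_algEquiv_of_root' (hint x).isAlgebraic ?_
  rwa [← minpoly.eq_of_irreducible_of_monic hirr hx hf]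

/-- Let `p` be prime and let `x` enumerate the roots of a polynomial of degree `p` with splitting
field of degree `p`. For an invariant valuation all roots have the same value, and so do all
differences of distinct roots. -/
theorem Valuation.exists_map_root_eq_and_map_root_sub_eq {K L Γ : Type*} [Field K] [Field L]
    [Algebra K L] [IsGalois K L] [LinearOrderedCommGroupWithZero Γ] (u : Valuation L Γ)
    (hu : ∀ (σ : L ≃ₐ[K] L) z, u (σ z) = u z) {f : K[X]} [IsSplittingField K L f] (hf : f.Monic)
    {p : ℕ} (hp : p.Prime) (hdeg : f.natDegree = p) (hdim : finrank K L = p)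
    (x : Fin p → L) (hroot : ∀ i, aeval (x i) f = 0) :
    ∃ c d : Γ, (∀ i, u (x i) = c) ∧ ∀ i j, x i ≠ x j → u (x i - x j) = d := by
  have : Fact p.Prime := ⟨hp⟩
  have : FiniteDimensional K L := IsSplittingField.finiteDimensional L f
  have hcard : Nat.card (L ≃ₐ[K] L) = p := (IsGalois.card_aut_eq_finrank K L).trans hdim
  have htrans (i j : Fin p) : ∃ σ : L ≃ₐ[K] L, σ (x i) = x j :=
    exists_algEquiv_apply_eq_of_finrank_eq_prime hf (hdeg ▸ hp) (hdim.trans hdeg.symm)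
      (hroot i) (hroot j)
  have hcomm (σ τ : L ≃ₐ[K] L) : σ * τ = τ * σ := by
    have : IsCyclic (L ≃ₐ[K] L) := isCyclic_of_prime_card hcard
    have : IsMulCommutative (L ≃ₐ[K] L) := IsCyclic.isMulCommutative
    exact mul_comm' σ τ
  let i₀ : Fin p := ⟨0, hp.pos⟩
  have : Nontrivial (L ≃ₐ[K] L) := Finite.one_lt_card_iff_nontrivial.1 (hcard ▸ hp.one_lt)
  obtain ⟨σ, hσ⟩ := exists_ne (1 : L ≃ₐ[K] L)
  refine ⟨u (x i₀), u (σ (x i₀) - x i₀), fun i ↦ ?_, fun i j hij ↦ ?_⟩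
  · obtain ⟨τ, hτ⟩ := htrans i₀ i
    rw [← hτ, hu]
  · obtain ⟨ρ, hρ⟩ := htrans i₀ j
    obtain ⟨τ, hτ⟩ := htrans j i
    have hτ1 : τ ≠ 1 := by
      rintro rfl
      exact hij hτ.symm
    rw [u.map_sub_eq_of_card_prime hcard hu hσ hτ1, ← hu ρ (τ (x i₀) - x i₀), _root_.map_sub ρ, hρ,
      ← AlgEquiv.mul_apply, hcomm, AlgEquiv.mul_apply, hρ, hτ]

/-- The Krasner argument for `f` and `f + t X ^ (p - 1)`, inside a finite normal extension `M`
that contains the splitting fields of both polynomials. -/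
theorem splits_of_splits_add_C_mul_X_pow {K L S M Γ : Type*} [Field K] [Field L] [Field S]
    [Field M] [Algebra K L] [Algebra K S] [Algebra K M] [LinearOrderedCommGroupWithZero Γ]
    (v : Valuation K Γ) [HenselianLocalRing v.valuationSubring] {p : ℕ} (hp : p.Prime)
    {f g : K[X]} (hmonic : f.Monic) (hdeg : f.natDegree = p) [IsSplittingField K L f]
    [IsGalois K L] (hdim : finrank K L = p) (w : Valuation L Γ)
    (hw : ∀ z : K, w (algebraMap K L z) = v z) (x : Fin p → L)
    (hroots : f.map (algebraMap K L) = ∏ i, (X - C (x i))) (t : K)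
    (ht : v t ^ (p * (p - 1)) * v (f.eval 0) ^ ((p - 1) ^ 2)
      < w (∏ i : Fin p, ∏ j : Fin p, if i < j then (x i - x j) ^ 2 else 1) ^ p)
    (hg : g = f + C t * X ^ (p - 1)) (hsplit : (g.map (algebraMap K S)).Splits)
    [FiniteDimensional K M] [Normal K M] (a : L →ₐ[K] M) (s : S →ₐ[K] M) :
    (f.map (algebraMap K S)).Splits := by
  have : FiniteDimensional K L := IsSplittingField.finiteDimensional L f
  have hlt : (C t * X ^ (p - 1)).degree < f.degree := by
    rw [degree_eq_natDegree hmonic.ne_zero, hdeg]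
    exact (degree_C_mul_X_pow_le _ _).trans_lt (by exact_mod_cast Nat.sub_lt hp.pos one_pos)
  have hgmonic : g.Monic := hg ▸ hmonic.add_of_left hlt
  have hgdeg : g.natDegree = p := by
    rw [hg, natDegree_add_eq_left_of_degree_lt hlt, hdeg]
  have hxinj : Function.Injective x := by
    have h0 : (∏ i : Fin p, ∏ j : Fin p, if i < j then (x i - x j) ^ 2 else 1) ≠ 0 := by
      intro h0
      rw [h0, map_zero, zero_pow hp.ne_zero] at ht
      exact not_lt_zero ht
    simp only [Finset.prod_ne_zero_iff] at h0
    have hne (i j : Fin p) (hij : i < j) : x i ≠ x j := fun h ↦ by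
      simpa [hij, h] using h0 i (Finset.mem_univ i) j (Finset.mem_univ j)
    intro i j h
    by_contra hij
    exact (lt_or_gt_of_ne hij).elim (fun hlt ↦ hne i j hlt h) fun hlt ↦ hne j i hlt h.symm
  have hroot (i : Fin p) : aeval (x i) f = 0 := by
    rw [← eval_map_algebraMap, hroots, eval_prod]
    exact Finset.prod_eq_zero (Finset.mem_univ i) (by simp)
  -- The unique extension of the valuation to `M`.
  obtain ⟨A, hA⟩ := ValuationSubring.exists_mem_iff_isIntegral v.valuationSubring K M
  let u := A.valuation
  have hu (z : M) : u z ≤ 1 ↔ IsIntegral v.valuationSubring z :=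
    (A.valuation_le_one_iff z).trans (hA z)
  have huM := u.map_algEquiv_of_le_one_iff_isIntegral (K := K) hu
  have huL := (u.comap (a : L →+* M)).map_algEquiv_of_le_one_iff_isIntegral (K := K)
    fun z ↦ (hu (a z)).trans
      (isIntegral_algHom_iff (a.restrictScalars v.valuationSubring) a.injective)
  have huK : v.IsEquiv (u.comap (algebraMap K M)) :=
    Valuation.isEquiv_iff_val_le_one.2 fun {z} ↦ by
      rw [Valuation.comap_apply, hu, isIntegral_algebraMap_iff (algebraMap K M).injective,
        IsIntegrallyClosed.isIntegral_iff]
      exact ⟨fun h ↦ ⟨⟨z, h⟩, rfl⟩, fun ⟨y, hy⟩ ↦ hy ▸ y.2⟩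
  obtain ⟨c, d, hc, hd⟩ := Valuation.exists_map_root_eq_and_map_root_sub_eq
    (u.comap (a : L →+* M)) huL hmonic hp hdeg hdim x hroot
  replace hc (i : Fin p) : u (a (x i)) = c := hc i
  replace hd (i j : Fin p) (h : x i ≠ x j) : u (a (x i) - a (x j)) = d := by
    rw [← map_sub]
    exact hd i j h
  have hfM : f.map (algebraMap K M) = ∏ i, (X - C (a (x i))) := by
    rw [← a.comp_algebraMap, ← map_map, hroots, Polynomial.map_prod]
    simp
  -- The hypothesis on `t`, in terms of the common values `c` and `d`.
  have hbound : u (algebraMap K M t) * c ^ (p - 1) < d ^ p := by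
    obtain ⟨D, hD⟩ := exists_algebraMap_eq_prod_sub_sq x hxinj hroots
    have huD : u (algebraMap K M D) = d ^ (p * (p - 1)) := by
      rw [← prod_prod_ite_lt_sq, ← a.commutes, hD]
      simp only [map_prod]
      refine Finset.prod_congr rfl fun i _ ↦ Finset.prod_congr rfl fun j _ ↦ ?_
      split_ifs with hij
      · rw [map_pow, map_pow, map_sub, hd i j (hxinj.ne hij.ne)]
      · rw [map_one, map_one]
    have huf : u (algebraMap K M (f.eval 0)) = c ^ p := by
      rw [← eval_map_apply, map_zero, hfM, eval_prod, map_prod]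
      simp [hc]
    rw [← hD, hw, ← map_pow, ← map_pow, ← map_pow, ← map_mul] at ht
    replace ht := huK.lt_iff_lt.1 ht
    simp only [Valuation.comap_apply, map_mul, map_pow, huD, huf] at ht
    refine lt_of_pow_lt_pow_left₀ (p * (p - 1)) zero_le ?_
    convert ht using 1
    · rw [mul_pow, ← pow_mul, ← pow_mul]
      ring_nf
    · rw [← pow_mul, ← pow_mul, mul_comm]
  have hmem (i : Fin p) : a (x i) ∈ s.fieldRange := by
    have hmap : g.map (algebraMap K M) = (g.map (algebraMap K S)).map s := by
      rw [map_map, AlgHom.comp_algebraMap]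
    obtain ⟨y, hy, hlt⟩ := u.exists_root_map_sub_lt (hgmonic.map (algebraMap K M))
      (hmap ▸ hsplit.map (s : S →+* M)) (a (x i)) (d := d) (by
        have hfi : eval₂ (algebraMap K M) (a (x i)) f = 0 := by
          rw [← aeval_def, aeval_algHom_apply, hroot, map_zero]
        rw [natDegree_map, hgdeg, eval_map, hg, eval₂_add, hfi, zero_add]
        simpa [hc] using hbound)
    rw [hmap, hsplit.roots_map, Multiset.mem_map] at hy
    obtain ⟨y, -, rfl⟩ := hy
    refine u.mem_intermediateField_of_krasner huM s.fieldRange ?_ ⟨y, rfl⟩ fun x' hx' hne ↦ ?_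
    · rw [IsSeparable, minpoly.algHom_eq a a.injective]
      exact Algebra.IsSeparable.isSeparable K (x i)
    · have hx'0 : aeval x' f = 0 := by
        refine aeval_eq_zero_of_dvd_aeval_eq_zero (minpoly.dvd K (a (x i)) ?_) hx'.aeval_eq_zero
        rw [aeval_algHom_apply, hroot, map_zero]
      rw [← eval_map_algebraMap, hfM, eval_prod, Finset.prod_eq_zero_iff] at hx'0
      obtain ⟨j, -, hj⟩ := hx'0
      have hj : x' = a (x j) := by simpa [sub_eq_zero] using hj
      rw [hj, hd i j fun h ↦ hne (by rw [h, hj])]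
      exact hlt
  choose r hr using hmem
  have hfr : f.map (algebraMap K S) = ∏ i, (X - C (r i)) := by
    refine Polynomial.map_injective (s : S →+* M) s.injective ?_
    rw [map_map, AlgHom.comp_algebraMap, hfM, Polynomial.map_prod]
    refine Finset.prod_congr rfl fun i _ ↦ ?_
    simpa using (hr i).symm
  rw [hfr]
  exact Splits.prod fun i _ ↦ Splits.X_sub_C _

/-- Krasner-type lemma: (K,v) henselian valued field, f ∈ 𝒪_v[X] monic of prime degree p
with cyclic splitting field of degree p. If t ∈ K satisfies
p(p−1)·v(t) > p·v(Disc f) − (p−1)²·v(f(0)) (written multiplicatively below, with the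
discriminant expressed as the product of squared root differences in the splitting
field), then the splitting field of f_t = f + t·X^{p−1} contains the splitting field
of f. -/
theorem stmt_7 (K : Type*) [Field K] (Γ : Type*) [LinearOrderedCommGroupWithZero Γ]
    (v : Valuation K Γ) [HenselianLocalRing ↥v.valuationSubring]
    (p : ℕ) (hp : p.Prime) [NeZero p]
    (f : Polynomial K) (hmonic : f.Monic) (hdeg : f.natDegree = p)
    (hint : ∀ i, f.coeff i ∈ v.valuationSubring)
    [IsGalois K f.SplittingField]
    (hcyc : IsCyclic (f.SplittingField ≃ₐ[K] f.SplittingField))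
    (hdim : Module.finrank K f.SplittingField = p)
    (w : Valuation f.SplittingField Γ)
    (hw : ∀ x : K, w (algebraMap K f.SplittingField x) = v x)
    (x : Fin p → f.SplittingField)
    (hroots : f.map (algebraMap K f.SplittingField) = ∏ i : Fin p, (X - C (x i)))
    (t : K)
    -- multiplicative form of p(p−1)·v(t) + (p−1)²·v(f(0)) > p·v(Disc f):
    (ht : v t ^ (p * (p - 1)) * v (f.eval 0) ^ ((p - 1) ^ 2)
        < w (∏ i : Fin p, ∏ j : Fin p, if i < j then (x i - x j) ^ 2 else 1) ^ p) :
    Nonempty (f.SplittingField →ₐ[K] (f + C t * X ^ (p - 1)).SplittingField) := by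
  let g := f + C t * X ^ (p - 1)
  have hg : g ≠ 0 := by
    refine (hmonic.add_of_left ?_ : g.Monic).ne_zero
    rw [degree_eq_natDegree hmonic.ne_zero, hdeg]
    exact (degree_C_mul_X_pow_le _ _).trans_lt (by exact_mod_cast Nat.sub_lt hp.pos one_pos)
  have hfg := SplittingField.splits (f * g)
  have hfg0 : (f * g).map (algebraMap K (f * g).SplittingField) ≠ 0 :=
    (Polynomial.map_ne_zero_iff (algebraMap K (f * g).SplittingField).injective).2
      (mul_ne_zero hmonic.ne_zero hg)
  have : Normal K (f * g).SplittingField := Normal.of_isSplittingField (f * g)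
  exact ⟨SplittingField.lift f (splits_of_splits_add_C_mul_X_pow v hp hmonic hdeg hdim w hw x
    hroots t ht rfl (SplittingField.splits g)
    (SplittingField.lift f (hfg.of_dvd hfg0 (Polynomial.map_dvd _ (dvd_mul_right f g))))
    (SplittingField.lift g (hfg.of_dvd hfg0 (Polynomial.map_dvd _ (dvd_mul_left g f)))))⟩
end

section
/- Let F/K be a function field in one variable, v a ℤ-valuation on F trivial on K, A a central simple F-algebra of prime degree p such that A is non-split over the henselisation F_v, and let f ∈ 𝒪_v[X] be monic of degree p with reduction modulo m_v irreducible over the residue field Fv. Then for t ∈ F: if v(t) < 0 and M ∈ ℕ satisfies M·v(t) + v(Disc(f)) < 0 (e.g. M > v(Disc(f))/(−v(t)), in particular any M > v(Disc(f)) works when v(t) ≤ −1), the polynomial f(X) + s·X^{p−1} with v(s) = M·v(t) + v(Disc(f)) < 0 has a root in F_v, and hence A is non-split over the splitting field of f(X) + s·X^{p−1} over F. -/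
open Polynomial
open scoped TensorProduct

universe u

/-- An algebra over a field is split if it is isomorphic to a matrix algebra. -/
def IsSplitAlgebra (F A : Type*) [Field F] [Ring A] [Algebra F A] : Prop :=
  ∃ n : ℕ, 0 < n ∧ Nonempty (A ≃ₐ[F] Matrix (Fin n) (Fin n) F)

/-- (Fv, Ov) is a henselisation of the valued field (F, O): a henselian valued
algebraic extension of (F, O) which is initial among henselian valued extensions. -/
def IsHenselization (F : Type u) [Field F] (O : ValuationSubring F)
    (Fv : Type u) [Field Fv] [Algebra F Fv] (Ov : ValuationSubring Fv) : Prop :=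
  (∀ x : F, x ∈ O ↔ algebraMap F Fv x ∈ Ov) ∧
  HenselianLocalRing ↥Ov ∧
  Algebra.IsAlgebraic F Fv ∧
  ∀ (E : Type u) [Field E] [Algebra F E] (OE : ValuationSubring E),
    (∀ x : F, x ∈ O ↔ algebraMap F E x ∈ OE) → HenselianLocalRing ↥OE →
    ∃ g : Fv →ₐ[F] E, ∀ y : Fv, y ∈ Ov → g y ∈ OE


/-- A polynomial of degree less than a prime `p` splits over some finite extension of degree
prime to `p`. -/
theorem exists_splits_not_dvd_finrank {p : ℕ} (hp : p.Prime) (n : ℕ) :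
    ∀ (k : Type u) [Field k] (h : k[X]), h.natDegree = n → n < p →
      ∃ (E : Type u) (_ : Field E) (_ : Algebra k E), FiniteDimensional k E ∧
        (h.map (algebraMap k E)).Splits ∧ ¬ p ∣ Module.finrank k E := by
  induction n with
  | zero =>
    intro k _ h hn _
    refine ⟨k, inferInstance, inferInstance, inferInstance, ?_, ?_⟩
    · exact Splits.of_natDegree_eq_zero (by simpa using hn)
    · simpa using hp.one_lt.ne'
  | succ n ih =>
    intro k _ h hn hlt
    have h0 : h.natDegree ≠ 0 := by omega
    have hirr := irreducible_factor h
    have : Fact (Irreducible h.factor) := ⟨hirr⟩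
    have hdvd := factor_dvd_of_natDegree_ne_zero h0
    have hne : h ≠ 0 := by rintro rfl; simp at h0
    obtain ⟨E, _, _, hfin, hsplit, hfr⟩ := ih (AdjoinRoot h.factor) h.removeFactor
      (natDegree_removeFactor' hn) (by omega)
    let : Algebra k E := ((algebraMap (AdjoinRoot h.factor) E).comp
      (algebraMap k (AdjoinRoot h.factor))).toAlgebra
    have : IsScalarTower k (AdjoinRoot h.factor) E := IsScalarTower.of_algebraMap_eq fun _ => rfl
    let pb := AdjoinRoot.powerBasis hirr.ne_zero
    have : FiniteDimensional k (AdjoinRoot h.factor) := pb.finite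
    refine ⟨E, inferInstance, inferInstance, FiniteDimensional.trans k (AdjoinRoot h.factor) E,
      ?_, ?_⟩
    · rw [IsScalarTower.algebraMap_eq k (AdjoinRoot h.factor) E, ← Polynomial.map_map,
        AdjoinRoot.algebraMap_eq, ← X_sub_C_mul_removeFactor h h0, Polynomial.map_mul]
      exact Splits.mul (by simp) hsplit
    · rw [← Module.finrank_mul_finrank k (AdjoinRoot h.factor) E, hp.dvd_mul, not_or]
      refine ⟨fun hd => ?_, hfr⟩
      rw [pb.finrank, AdjoinRoot.powerBasis_dim] at hd
      have := Nat.le_of_dvd hirr.natDegree_pos hd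
      have := natDegree_le_of_dvd hdvd hne
      omega

/-- Iterated base change of a (not necessarily commutative) algebra. -/
theorem nonempty_algEquiv_baseChange_baseChange (F L E A : Type*) [Field F] [Field L] [Field E]
    [Algebra F L] [Algebra L E] [Algebra F E] [IsScalarTower F L E] [Ring A] [Algebra F A] :
    Nonempty (E ⊗[L] (L ⊗[F] A) ≃ₐ[E] E ⊗[F] A) :=
  ⟨AlgEquiv.symm <| AlgEquiv.ofLinearEquiv
    (TensorProduct.AlgebraTensorModule.cancelBaseChange F L E E A).symm
    (by simp [Algebra.TensorProduct.one_def]) <|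
      LinearMap.map_mul_of_map_mul_tmul (fun _ _ _ _ ↦ by simp)⟩

theorem IsSplitAlgebra.of_algEquiv {k B C : Type*} [Field k] [Ring B] [Ring C] [Algebra k B]
    [Algebra k C] (e : B ≃ₐ[k] C) (h : IsSplitAlgebra k C) : IsSplitAlgebra k B := by
  obtain ⟨n, hn, ⟨g⟩⟩ := h
  exact ⟨n, hn, ⟨e.trans g⟩⟩

theorem IsSplitAlgebra.baseChange {L B : Type*} (E : Type*) [Field L] [Field E] [Algebra L E]
    [Ring B] [Algebra L B] (h : IsSplitAlgebra L B) : IsSplitAlgebra E (E ⊗[L] B) := by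
  obtain ⟨n, hn, ⟨g⟩⟩ := h
  refine ⟨n, hn, ⟨(Algebra.TensorProduct.congr (AlgEquiv.refl : E ≃ₐ[E] E) g).trans ?_⟩⟩
  refine AlgEquiv.ofRingEquiv (f := (matrixEquivTensor (Fin n) L E).symm.toRingEquiv) fun r => ?_
  change (matrixEquivTensor (Fin n) L E).symm (r ⊗ₜ[L] 1) = _
  rw [matrixEquivTensor_apply_symm, Algebra.algebraMap_eq_smul_one]
  ext i j
  by_cases hij : i = j <;> simp [hij]

/-- Simplicity of an algebra descends along field extensions. -/
theorem isSimpleRing_of_baseChange (k E B : Type*) [Field k] [Field E] [Algebra k E]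
    [Ring B] [Algebra k B] [IsSimpleRing (E ⊗[k] B)] : IsSimpleRing B := by
  have hinj : Function.Injective (Algebra.TensorProduct.includeRight : B →ₐ[k] E ⊗[k] B) :=
    Algebra.TensorProduct.includeRight_injective (algebraMap k E).injective
  have : Nontrivial B := by
    by_contra hB
    rw [not_nontrivial_iff_subsingleton] at hB
    exact not_subsingleton (E ⊗[k] B) inferInstance
  refine .of_eq_bot_or_eq_top fun I => ?_
  let q : B →ₐ[k] I.ringCon.Quotient := { I.ringCon.mk' with commutes' := fun _ => rfl }
  rcases subsingleton_or_nontrivial I.ringCon.Quotient with hs | hs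
  · right
    refine top_le_iff.mp fun b _ => ?_
    rw [← I.ker_ringCon_mk', TwoSidedIdeal.mem_ker]
    exact Subsingleton.elim _ _
  · left
    have hφ := (Algebra.TensorProduct.map (AlgHom.id E E) q).toRingHom.injective
    rw [← I.ker_ringCon_mk', TwoSidedIdeal.ker_eq_bot]
    intro a b hab
    apply hinj
    apply hφ
    have : q a = q b := hab
    simp [this]

/-- An algebra of prime degree `p` which splits over a finite extension of degree prime to `p`
is already split. -/
theorem IsSplitAlgebra.of_baseChange_of_not_dvd_finrank {k E B : Type*} [Field k] [Field E]
    [Algebra k E] [FiniteDimensional k E] [Ring B] [Algebra k B] {p : ℕ} (hp : p.Prime)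
    (hB : Module.finrank k B = p ^ 2) (hE : ¬ p ∣ Module.finrank k E)
    (h : IsSplitAlgebra E (E ⊗[k] B)) : IsSplitAlgebra k B := by
  obtain ⟨n, hn, ⟨e⟩⟩ := h
  have : NeZero n := ⟨hn.ne'⟩
  have hnp : n = p := by
    have h1 := e.toLinearEquiv.finrank_eq
    rw [Module.finrank_baseChange, hB, Module.finrank_matrix] at h1
    simp only [Fintype.card_fin, Module.finrank_self, mul_one, ← sq] at h1
    exact (Nat.pow_left_injective two_ne_zero h1).symm
  subst hnp
  have : FiniteDimensional k B := Module.finite_of_finrank_pos (by rw [hB]; positivity)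
  have : IsSimpleRing (E ⊗[k] B) := IsSimpleRing.of_ringEquiv e.symm.toRingEquiv inferInstance
  have : IsSimpleRing B := isSimpleRing_of_baseChange k E B
  have : IsArtinianRing B := IsArtinianRing.of_finite k B
  obtain ⟨m, hm, D, _, _, _, ⟨g⟩⟩ := IsSimpleRing.exists_algEquiv_matrix_divisionRing_finite k B
  have hdim : m ^ 2 * Module.finrank k D = n ^ 2 := by
    have h1 := g.toLinearEquiv.finrank_eq
    rw [hB, Module.finrank_matrix] at h1
    simp only [Fintype.card_fin] at h1
    rw [h1, sq]
  have hmn : m ∣ n := (Nat.pow_dvd_pow_iff two_ne_zero).mp (Dvd.intro _ hdim)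
  rcases (Nat.dvd_prime hp).mp hmn with rfl | rfl
  · exfalso
    let ψ : D →ₐ[k] Module.End E (Fin n → E) :=
      (Matrix.toLinAlgEquiv'.toAlgHom.restrictScalars k).comp
        ((e.toAlgHom.restrictScalars k).comp (Algebra.TensorProduct.includeRight.comp
          (g.symm.toAlgHom.comp (Matrix.scalarAlgHom (Fin 1) k))))
    let : Module D (Fin n → E) := Module.compHom _ ψ.toRingHom
    have : IsScalarTower k D (Fin n → E) := ⟨fun a d w => by
      change ψ (a • d) w = a • ψ d w
      rw [map_smul]; rfl⟩
    have h2 := Module.finrank_mul_finrank k D (Fin n → E)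
    have h3 : Module.finrank k (Fin n → E) = n * Module.finrank k E := by
      simp [Module.finrank_pi_fintype]
    rw [h3, show Module.finrank k D = n ^ 2 by simpa using hdim, sq, mul_assoc] at h2
    exact hE ⟨_, (Nat.eq_of_mul_eq_mul_left hn h2).symm⟩
  · have h1 : Module.finrank k D = 1 :=
      Nat.eq_of_mul_eq_mul_left (by positivity : 0 < m ^ 2) (by rw [hdim, mul_one])
    have hbij : Function.Bijective (Algebra.ofId k D) :=
      Algebra.bijective_algebraMap_iff.mpr (Subalgebra.bot_eq_top_of_finrank_eq_one h1).symm
    exact ⟨m, hn, ⟨g.trans (AlgEquiv.ofBijective _ hbij).symm.mapMatrix⟩⟩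

/-- Over a henselian valued extension, adding to a monic integral polynomial of degree `p` a
term `s * X ^ (p - 1)` with `s` non-integral produces a root. -/
theorem exists_aeval_add_C_mul_X_pow_eq_zero {F Fv : Type*} [Field F] [Field Fv] [Algebra F Fv]
    (O : ValuationSubring F) (Ov : ValuationSubring Fv)
    (hmem : ∀ x : F, x ∈ O ↔ algebraMap F Fv x ∈ Ov) (hH : HenselianLocalRing Ov)
    (f₀ : O[X]) (hmonic : f₀.Monic) {p : ℕ} (hdeg : f₀.natDegree = p) (hp : 0 < p)
    {s : F} (hs : s ∉ O) :
    ∃ y : Fv, aeval y (f₀.map (algebraMap O F) + C s * X ^ (p - 1)) = 0 := by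
  have hs0 : s ≠ 0 := by rintro rfl; exact hs O.zero_mem
  let ι : O →+* Ov := ((algebraMap F Fv).comp O.subtype).codRestrict Ov.toSubring
    fun x => (hmem x).mp x.2
  have hr : algebraMap F Fv (-s⁻¹) ∈ Ov :=
    (hmem _).mp (O.neg_mem _ ((O.mem_or_inv_mem s).resolve_left hs))
  let r : Ov := ⟨algebraMap F Fv (-s⁻¹), hr⟩
  have hrval : (r : Fv) = -(algebraMap F Fv s)⁻¹ := by simp [r]
  have hsv : algebraMap F Fv s ≠ 0 := by simpa using hs0
  have hrm : r ∈ IsLocalRing.maximalIdeal Ov := by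
    rw [IsLocalRing.mem_maximalIdeal, mem_nonunits_iff]
    rintro hu
    obtain ⟨w, hw⟩ := hu.exists_right_inv
    have hw' : (r : Fv) * w = 1 := congrArg Subtype.val hw
    apply hs
    rw [hmem]
    have : algebraMap F Fv s = -(w : Fv) := by
      rw [hrval] at hw'
      field_simp at hw'
      linear_combination -hw'
    rw [this]
    exact Ov.neg_mem _ w.2
  have hgm : (f₀.map ι).Monic := hmonic.map ι
  have hgd : (f₀.map ι).natDegree = p := by rw [hmonic.natDegree_map, hdeg]
  let h : Ov[X] := (f₀.map ι).scaleRoots r - X ^ (p - 1)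
  have hscm : ((f₀.map ι).scaleRoots r).Monic := (monic_scaleRoots_iff r).mpr hgm
  have hm : h.Monic := by
    refine hscm.sub_of_left ?_
    rw [degree_X_pow, degree_eq_natDegree hscm.ne_zero, natDegree_scaleRoots, hgd]
    exact_mod_cast Nat.sub_lt hp one_pos
  have hres : h.map (IsLocalRing.residue Ov) = X ^ p - X ^ (p - 1) := by
    have hr0 : IsLocalRing.residue Ov r = 0 := (IsLocalRing.residue_eq_zero_iff r).mpr hrm
    simp only [h, Polynomial.map_sub, Polynomial.map_pow, map_X]
    rw [map_scaleRoots _ _ _ (by rw [hgm.leadingCoeff, map_one]; exact one_ne_zero), hr0,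
      scaleRoots_zero, (hgm.map _).leadingCoeff, hgm.natDegree_map, hgd, one_smul]
  obtain ⟨a, ha, -⟩ := hH.is_henselian h hm 1
    (by
      rw [← IsLocalRing.residue_eq_zero_iff, ← eval_map_apply, hres]
      simp)
    (by
      rw [← IsLocalRing.residue_ne_zero_iff_isUnit, ← eval_map_apply, ← derivative_map, hres]
      obtain ⟨q, rfl⟩ := Nat.exists_eq_succ_of_ne_zero hp.ne'
      simp [derivative_X_pow])
  have hr0 : (r : Fv) ≠ 0 := by rw [hrval]; simpa using hs0
  have hroot : ((f₀.map ι).scaleRoots r).eval a = a ^ (p - 1) := by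
    simpa [h, sub_eq_zero] using ha
  refine ⟨(a : Fv) / r, ?_⟩
  have key := scaleRoots_eval₂_mul (p := f₀.map ι) Ov.subtype ((a : Fv) / r) r
  rw [show Ov.subtype r * ((a : Fv) / r) = Ov.subtype a from mul_div_cancel₀ _ hr0, eval₂_hom,
    hroot, hgd, eval₂_map, map_pow] at key
  have hf : aeval ((a : Fv) / r) (f₀.map (algebraMap O F))
      = eval₂ (Ov.subtype.comp ι) ((a : Fv) / r) f₀ := by
    rw [aeval_def, eval₂_map]
    rfl
  change (a : Fv) ^ (p - 1) = (r : Fv) ^ p * _ at key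
  rw [map_add, hf, map_mul, aeval_C, map_pow, aeval_X, div_pow, key]
  have hsr : algebraMap F Fv s = -(r : Fv)⁻¹ := by rw [hrval]; simp
  obtain ⟨q, rfl⟩ := Nat.exists_eq_succ_of_ne_zero hp.ne'
  rw [hsr, Nat.succ_sub_one, pow_succ]
  field_simp
  ring

/-- F/K a function field in one variable, v a ℤ-valuation on F trivial on K, A a
central simple F-algebra of prime degree p non-split over the henselisation F_v, and
f ∈ 𝒪_v[X] monic of degree p with irreducible reduction mod m_v. If t ∈ F has
v(t) < 0 (multiplicatively 1 < v t) and M ∈ ℕ satisfies M·v(t) + v(Disc f) < 0, then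
for any s with v(s) = M·v(t) + v(Disc f) the polynomial f + s·X^{p−1} has a root in
F_v and A remains non-split over the splitting field of f + s·X^{p−1} over F. (The
discriminant is encoded as the element D of F whose image is the product of squared
root differences in a splitting field of f.) -/
theorem stmt_19 (K F : Type u) [Field K] [Field F] [Algebra K F]
    (tr : F) (htr : Transcendental K tr)
    [FiniteDimensional ↥(IntermediateField.adjoin K ({tr} : Set F)) F]
    (v : Valuation F (WithZero (Multiplicative ℤ)))
    (hKtriv : ∀ c : K, c ≠ 0 → v (algebraMap K F c) = 1)
    (hunif : ∃ π : F, v π = ↑(Multiplicative.ofAdd (-1 : ℤ)))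
    (p : ℕ) (hp : p.Prime) [NeZero p]
    (A : Type u) [Ring A] [Algebra F A] [FiniteDimensional F A] [IsSimpleRing A]
    (hcentral : Subalgebra.center F A = ⊥)
    (hdegA : Module.finrank F A = p ^ 2)
    (Fv : Type u) [Field Fv] [Algebra F Fv] (Ov : ValuationSubring Fv)
    (hhens : IsHenselization F v.valuationSubring Fv Ov)
    (hns : ¬ IsSplitAlgebra Fv (Fv ⊗[F] A))
    (f₀ : Polynomial ↥v.valuationSubring) (hmonic : f₀.Monic) (hdegf : f₀.natDegree = p)
    (hirr : Irreducible (f₀.map (IsLocalRing.residue ↥v.valuationSubring)))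
    (x : Fin p → (f₀.map (algebraMap ↥v.valuationSubring F)).SplittingField)
    (hroots : (f₀.map (algebraMap ↥v.valuationSubring F)).map
        (algebraMap F (f₀.map (algebraMap ↥v.valuationSubring F)).SplittingField)
      = ∏ i : Fin p, (X - C (x i)))
    (D : F)
    (hD : algebraMap F (f₀.map (algebraMap ↥v.valuationSubring F)).SplittingField D
      = ∏ i : Fin p, ∏ j : Fin p, if i < j then (x i - x j) ^ 2 else 1)
    (t : F) (ht : 1 < v t)
    (M : ℕ) (hM : 1 < v t ^ M * v D)
    (s : F) (hs : v s = v t ^ M * v D) :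
    (∃ y : Fv, Polynomial.aeval y
        (f₀.map (algebraMap ↥v.valuationSubring F) + C s * X ^ (p - 1)) = 0) ∧
    ¬ IsSplitAlgebra
        (f₀.map (algebraMap ↥v.valuationSubring F) + C s * X ^ (p - 1)).SplittingField
        ((f₀.map (algebraMap ↥v.valuationSubring F) + C s * X ^ (p - 1)).SplittingField
          ⊗[F] A) := by
  set g := f₀.map (algebraMap ↥v.valuationSubring F) + C s * X ^ (p - 1) with hg
  have hsO : s ∉ v.valuationSubring := by
    rw [Valuation.mem_valuationSubring_iff, not_le, hs]
    exact hM
  obtain ⟨y, hy⟩ := exists_aeval_add_C_mul_X_pow_eq_zero v.valuationSubring Ov hhens.1 hhens.2.1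
    f₀ hmonic hdegf hp.pos hsO
  refine ⟨⟨y, hy⟩, fun hsplit => hns ?_⟩
  have hgm : g.Monic := by
    refine (hmonic.map _).add_of_left ((degree_C_mul_X_pow_le _ _).trans_lt ?_)
    rw [degree_eq_natDegree (hmonic.map _).ne_zero, hmonic.natDegree_map, hdegf]
    exact_mod_cast Nat.sub_lt hp.pos one_pos
  have hgd : g.natDegree = p := by
    rw [hg, natDegree_add_eq_left_of_natDegree_lt, hmonic.natDegree_map, hdegf]
    rw [hmonic.natDegree_map, hdegf]
    exact (natDegree_C_mul_X_pow_le _ _).trans_lt (Nat.sub_lt hp.pos one_pos)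
  obtain ⟨q, hq⟩ := dvd_iff_isRoot.mpr
    (show (g.map (algebraMap F Fv)).IsRoot y by rwa [IsRoot, eval_map_algebraMap])
  have hqd : q.natDegree < p := by
    have hgd' := hgm.natDegree_map (algebraMap F Fv)
    have hq0 : q ≠ 0 := right_ne_zero_of_mul (hq ▸ (hgm.map (algebraMap F Fv)).ne_zero)
    rw [hq, natDegree_mul (X_sub_C_ne_zero y) hq0, natDegree_X_sub_C, hgd] at hgd'
    omega
  obtain ⟨E, _, _, _, hqE, hE⟩ := exists_splits_not_dvd_finrank hp _ Fv q rfl hqd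
  let _ : Algebra F E := ((algebraMap Fv E).comp (algebraMap F Fv)).toAlgebra
  have : IsScalarTower F Fv E := IsScalarTower.of_algebraMap_eq fun _ => rfl
  have hgE : (g.map (algebraMap F E)).Splits := by
    rw [IsScalarTower.algebraMap_eq F Fv E, ← Polynomial.map_map, hq, Polynomial.map_mul]
    exact Splits.mul (by simp) hqE
  let φ : g.SplittingField →ₐ[F] E := SplittingField.lift g hgE
  let _ : Algebra g.SplittingField E := φ.toRingHom.toAlgebra
  have : IsScalarTower F g.SplittingField E :=
    IsScalarTower.of_algebraMap_eq fun c => (φ.commutes c).symm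
  obtain ⟨e₁⟩ := nonempty_algEquiv_baseChange_baseChange F g.SplittingField E A
  obtain ⟨e₂⟩ := nonempty_algEquiv_baseChange_baseChange F Fv E A
  exact ((hsplit.baseChange E).of_algEquiv (e₂.trans e₁.symm)).of_baseChange_of_not_dvd_finrank hp
    (by rw [Module.finrank_baseChange, hdegA]) hE
end
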